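/- arXiv:2510.14568 — 2 statements merged into one kernel-verified Lean document; each statement's English description precedes it below -/
import Mathlib

section
/- Let G be a finite group, let F be an injective group cellular automaton on G, and fix k ∈ ℤ. Then F is expansive if and only if there exists a positive integer k_F such that: (1) for every c ∈ L(k) there exists n ∈ ℤ with |n| ≤ k_F and F^n(c)_j ≠ e for some j > k; and (2) for every c ∈ R(k) there exists n ∈ ℤ with |n| ≤ k_F and F^n(c)_j ≠ e for some j < k. -/
open Function Topology

/-- The prodiscrete (product of discrete) topology on configurations `ℤ → A`. -/
def configTop (A : Type*) : TopologicalSpace (ℤ → A) :=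
  @Pi.topologicalSpace ℤ (fun _ => A) (fun _ => ⊥)

/-- The shift map. -/
def shiftMap (A : Type*) : (ℤ → A) → (ℤ → A) := fun c i => c (i + 1)

open Classical in
/-- The Tychonoff distance on configurations. -/
noncomputable def tychDist {A : Type*} (c c' : ℤ → A) : ℝ :=
  if c = c' then 0
  else (2 : ℝ) ^ (-((sInf {n : ℕ | ∃ j : ℤ, j.natAbs = n ∧ c j ≠ c' j} : ℕ) : ℤ))

/-- The `n`-th iterate, `n ∈ ℤ`, of a map (negative powers via `Function.invFun`,
which is the genuine inverse whenever the map is bijective). -/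
noncomputable def zIter {A : Type*} [Nonempty A] (F : (ℤ → A) → (ℤ → A)) (n : ℤ) :
    (ℤ → A) → (ℤ → A) :=
  if 0 ≤ n then F^[n.toNat] else (Function.invFun F)^[(-n).toNat]

/-- Expansivity (for reversible maps). -/
def Expansive {A : Type*} [Nonempty A] (F : (ℤ → A) → (ℤ → A)) : Prop :=
  ∃ ε : ℝ, 0 < ε ∧ ∀ c c' : ℤ → A, c ≠ c' →
    ∃ n : ℤ, tychDist (zIter F n c) (zIter F n c') > ε

/-- Positive expansivity. -/
def PosExpansive {A : Type*} (F : (ℤ → A) → (ℤ → A)) : Prop :=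
  ∃ ε : ℝ, 0 < ε ∧ ∀ c c' : ℤ → A, c ≠ c' →
    ∃ n : ℕ, tychDist (F^[n] c) (F^[n] c') > ε

/-- Topological transitivity (w.r.t. the prodiscrete topology). -/
def TopTransitive {A : Type*} (F : (ℤ → A) → (ℤ → A)) : Prop :=
  ∀ U V : Set (ℤ → A), IsOpen[configTop A] U → IsOpen[configTop A] V →
    U.Nonempty → V.Nonempty → ∃ n : ℕ, (F^[n] '' U ∩ V).Nonempty

/-- Left fronts. -/
def Lset (G : Type*) [One G] (k : ℤ) : Set (ℤ → G) := {c | c k ≠ 1 ∧ ∀ i > k, c i = 1}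

/-- Right fronts. -/
def Rset (G : Type*) [One G] (k : ℤ) : Set (ℤ → G) := {c | c k ≠ 1 ∧ ∀ i < k, c i = 1}

/-- The position of a front: the largest index where it differs from the identity. -/
noncomputable def pos {G : Type*} [One G] (c : ℤ → G) : ℤ := sSup {j : ℤ | c j ≠ 1}

/-- `kF` is an expansivity constant for `F`. -/
def ExpConstant {G : Type*} [Group G] (F : (ℤ → G) → (ℤ → G)) (kF : ℕ) : Prop :=
  0 < kF ∧ ∀ k : ℤ,
    (∀ c ∈ Lset G k, ∃ n : ℤ, n.natAbs ≤ kF ∧ pos (zIter F n c) > k) ∧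
    (∀ c ∈ Rset G k, ∃ n : ℤ, n.natAbs ≤ kF ∧ ∃ j < k, zIter F n c j ≠ 1)

/-- `ρ` is a radius of `F`. -/
def IsRadius {A : Type*} (F : (ℤ → A) → (ℤ → A)) (ρ : ℕ) : Prop :=
  ∀ c c' : ℤ → A, ∀ i : ℤ, (∀ j : ℤ, |j - i| ≤ (ρ : ℤ) → c j = c' j) → F c i = F c' i

theorem zpow_neg_lt_tychDist_iff {A : Type*} (c c' : ℤ → A) (N : ℕ) :
    (2 : ℝ) ^ (-(N : ℤ)) < tychDist c c' ↔ ∃ j : ℤ, j.natAbs < N ∧ c j ≠ c' j := by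
  by_cases h : c = c'
  · subst h
    simp only [tychDist, if_true, ne_eq, not_true_eq_false, and_false, exists_false, iff_false,
      not_lt]
    positivity
  · rw [tychDist, if_neg h, zpow_lt_zpow_iff_right₀ one_lt_two, neg_lt_neg_iff, Nat.cast_lt]
    constructor
    · intro hlt
      obtain ⟨i, hi⟩ := Function.ne_iff.mp h
      have hne : {n : ℕ | ∃ j : ℤ, j.natAbs = n ∧ c j ≠ c' j}.Nonempty := ⟨_, i, rfl, hi⟩
      obtain ⟨j, hj, hcj⟩ := Nat.sInf_mem hne
      exact ⟨j, hj ▸ hlt, hcj⟩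
    · rintro ⟨j, hj, hcj⟩
      exact lt_of_le_of_lt (Nat.sInf_le ⟨j, rfl, hcj⟩) hj

/-- Expansivity in terms of a uniform finite window. -/
theorem expansive_iff_exists_window {A : Type*} [Nonempty A] (F : (ℤ → A) → (ℤ → A)) :
    Expansive F ↔ ∃ N : ℕ, ∀ c c' : ℤ → A, c ≠ c' →
      ∃ n j : ℤ, j.natAbs < N ∧ zIter F n c j ≠ zIter F n c' j := by
  constructor
  · rintro ⟨ε, hε, h⟩
    obtain ⟨N, hN⟩ := exists_pow_lt_of_lt_one hε (by norm_num : (2⁻¹ : ℝ) < 1)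
    refine ⟨N, fun c c' hc => ?_⟩
    obtain ⟨n, hn⟩ := h c c' hc
    refine ⟨n, (zpow_neg_lt_tychDist_iff _ _ N).mp (lt_trans ?_ hn)⟩
    simpa using hN
  · rintro ⟨N, h⟩
    refine ⟨(2 : ℝ) ^ (-(N : ℤ)), by positivity, fun c c' hc => ?_⟩
    obtain ⟨n, hn⟩ := h c c' hc
    exact ⟨n, (zpow_neg_lt_tychDist_iff _ _ N).mpr hn⟩

theorem map_translate_of_comp_shiftMap {A : Type*} {F : (ℤ → A) → (ℤ → A)}
    (hF : F ∘ shiftMap A = shiftMap A ∘ F) (t : ℤ) (c : ℤ → A) :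
    F (fun i => c (i + t)) = fun i => F c (i + t) := by
  have h1 (c : ℤ → A) : F (fun i => c (i + 1)) = fun i => F c (i + 1) := congrFun hF c
  induction t using Int.induction_on generalizing c with
  | zero => simp
  | succ n ih =>
    have := ih (fun i => c (i + 1))
    rw [h1] at this
    simpa only [add_assoc] using this
  | pred n ih =>
    have h2 := h1 (fun i => c (i - 1))
    simp only [add_sub_cancel_right] at h2
    have h3 : F (fun i => c (i - 1)) = fun i => F c (i - 1) := by
      rw [h2]
      simp
    have := ih (fun i => c (i - 1))
    rw [h3] at this
    simpa only [add_sub_assoc] using this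

/-- An injective cellular automaton is surjective. -/
theorem surjective_of_injective_of_translate {A : Type*} [Finite A] [TopologicalSpace A]
    [DiscreteTopology A] {F : (ℤ → A) → (ℤ → A)} (hcont : Continuous F)
    (hF : ∀ (t : ℤ) (c : ℤ → A), F (fun i => c (i + t)) = fun i => F c (i + t))
    (hinj : Injective F) : Surjective F := by
  have hper (p : ℕ) [NeZero p] (f : ZMod p → A) :
      ∃ c, F c = fun i : ℤ => f i := by
    have hmod (g : ZMod p → A) (i : ℤ) :
        F (fun i : ℤ => g i) ((i : ZMod p).cast) = F (fun i : ℤ => g i) i := by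
      have h := congrFun (hF ((i : ZMod p).cast - i) (fun i : ℤ => g i)) i
      simpa using h.symm
    let φ : (ZMod p → A) → (ZMod p → A) := fun g z => F (fun i : ℤ => g i) (z.cast)
    have hφ : Injective φ := by
      intro g g' h
      have h' : F (fun i : ℤ => g i) = F (fun i : ℤ => g' i) := by
        funext i
        rw [← hmod g, ← hmod g']
        exact congrFun h (i : ZMod p)
      funext z
      obtain ⟨i, rfl⟩ := ZMod.intCast_surjective z
      exact congrFun (hinj h') i
    obtain ⟨g, rfl⟩ := Finite.surjective_of_injective hφ f
    exact ⟨fun i : ℤ => g i, funext fun i => (hmod g i).symm⟩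
  have hclosed : IsClosed (Set.range F) := (isCompact_range hcont).isClosed
  intro y
  change y ∈ Set.range F
  rw [← hclosed.closure_eq, mem_closure_iff_nhds]
  intro U hU
  rw [nhds_pi, Filter.mem_pi] at hU
  obtain ⟨I, hI, t, ht, htU⟩ := hU
  obtain ⟨m, hm⟩ := (hI.image Int.natAbs).bddAbove
  obtain ⟨c, hc⟩ := hper (2 * m + 1) (fun z => y z.valMinAbs)
  refine ⟨F c, htU fun i hi => ?_, c, rfl⟩
  have him : i.natAbs ≤ m := hm ⟨i, hi, rfl⟩
  have hval : ((i : ZMod (2 * m + 1))).valMinAbs = i :=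
    (ZMod.valMinAbs_spec _ _).mpr ⟨rfl, by constructor <;> push_cast <;> omega⟩
  rw [hc]
  simp only [hval]
  exact mem_of_mem_nhds (ht i)

section MulAut

variable {G : Type*} [Group G]

theorem zIter_eq_zpow {F : (ℤ → G) → (ℤ → G)} {e : MulAut (ℤ → G)} (he : ⇑e = F) (n : ℤ) :
    zIter F n = ⇑(e ^ n) := by
  have hpow (e : MulAut (ℤ → G)) (m : ℕ) : (⇑e)^[m] = ⇑(e ^ m) := by
    induction m with
    | zero => rfl
    | succ m ih => rw [Function.iterate_succ, ih, pow_succ, MulAut.coe_mul]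
  have hinv : invFun F = ⇑(e⁻¹) := by
    subst he
    funext c
    apply e.injective
    rw [MulAut.apply_inv_self, invFun_eq (e.surjective c)]
  unfold zIter
  split_ifs with h
  · conv_rhs => rw [← Int.toNat_of_nonneg h]
    rw [zpow_natCast, ← he, hpow]
  · rw [hinv, hpow, ← zpow_natCast, inv_zpow', Int.toNat_of_nonneg (by omega), neg_neg]

/-- Translation of configurations as a group automorphism. -/
def translation (G : Type*) [Group G] (t : ℤ) : MulAut (ℤ → G) where
  toFun c i := c (i + t)
  invFun c i := c (i - t)
  left_inv c := by simp
  right_inv c := by simp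
  map_mul' _ _ := rfl

theorem zpow_apply_translate {e : MulAut (ℤ → G)} (he : ∀ t, Commute e (translation G t))
    (n t : ℤ) (c : ℤ → G) : (e ^ n) (fun i => c (i + t)) = fun i => (e ^ n) c (i + t) :=
  DFunLike.congr_fun ((he t).zpow_left n).eq c

/-- A continuous translation-invariant automorphism has a finite radius. -/
theorem exists_radius [TopologicalSpace G] [DiscreteTopology G] {e : MulAut (ℤ → G)}
    (hcont : Continuous e) (he : ∀ t, Commute e (translation G t)) :
    ∃ r : ℕ, ∀ (c : ℤ → G) (i : ℤ), (∀ j, i - r ≤ j → j ≤ i + r → c j = 1) → e c i = 1 := by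
  have hU : {c : ℤ → G | e c 0 = 1} ∈ 𝓝 (1 : ℤ → G) := by
    apply ((isOpen_discrete {(1 : G)}).preimage ((continuous_apply 0).comp hcont)).mem_nhds
    simp
  rw [nhds_pi, Filter.mem_pi] at hU
  obtain ⟨I, hI, t, ht, htU⟩ := hU
  obtain ⟨r, hr⟩ := (hI.image Int.natAbs).bddAbove
  refine ⟨r, fun c i hc => ?_⟩
  have h0 : e (fun j => c (j + i)) 0 = 1 := by
    apply htU
    intro j hj
    have hjr : j.natAbs ≤ r := hr ⟨j, hj, rfl⟩
    simp only [hc (j + i) (by omega) (by omega)]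
    exact mem_of_mem_nhds (ht j)
  have := zpow_apply_translate he 1 i c
  rw [zpow_one] at this
  simpa [this] using h0

/-- The part of a configuration supported on negative indices. -/
def leftPart (c : ℤ → G) : ℤ → G := fun i => if i < 0 then c i else 1

/-- The part of a configuration supported on nonnegative indices. -/
def rightPart (c : ℤ → G) : ℤ → G := fun i => if i < 0 then 1 else c i

theorem leftPart_mul_rightPart (c : ℤ → G) : leftPart c * rightPart c = c := by
  funext i
  by_cases h : i < 0 <;> simp [leftPart, rightPart, h]

theorem map_leftPart {e : MulAut (ℤ → G)} {r : ℕ}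
    (hr : ∀ (c : ℤ → G) (i : ℤ), (∀ j, i - r ≤ j → j ≤ i + r → c j = 1) → e c i = 1)
    {c : ℤ → G} (hc : ∀ j : ℤ, j.natAbs ≤ r → c j = 1) :
    e (leftPart c) = leftPart (e c) := by
  funext i
  by_cases h : i < 0
  · have hR : e (rightPart c) i = 1 := by
      refine hr _ _ fun j h1 h2 => ?_
      by_cases hj : j < 0
      · simp [rightPart, hj]
      · simp only [rightPart, hj, if_false]
        exact hc j (by omega)
    have hmul : e c i = e (leftPart c) i * e (rightPart c) i := by
      conv_lhs => rw [← leftPart_mul_rightPart c, map_mul]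
      rfl
    rw [hR, mul_one] at hmul
    simp [leftPart, h, ← hmul]
  · have hL : e (leftPart c) i = 1 := by
      refine hr _ _ fun j h1 h2 => ?_
      by_cases hj : j < 0
      · simp only [leftPart, hj, if_true]
        exact hc j (by omega)
      · simp [leftPart, hj]
    simp [hL, leftPart, h]

theorem zpow_map_leftPart {e : MulAut (ℤ → G)} {r : ℕ}
    (hr : ∀ (c : ℤ → G) (i : ℤ), (∀ j, i - r ≤ j → j ≤ i + r → c j = 1) → e c i = 1)
    (hr' : ∀ (c : ℤ → G) (i : ℤ), (∀ j, i - r ≤ j → j ≤ i + r → c j = 1) → e⁻¹ c i = 1)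
    {c : ℤ → G} (hc : ∀ n j : ℤ, j.natAbs ≤ r → (e ^ n) c j = 1) (n : ℤ) :
    (e ^ n) (leftPart c) = leftPart ((e ^ n) c) := by
  induction n using Int.induction_on with
  | zero => simp
  | succ n ih => simp only [add_comm (n : ℤ), zpow_add, zpow_one, MulAut.mul_apply, ih,
      map_leftPart hr (hc n)]
  | pred n ih => simp only [sub_eq_neg_add _ (1 : ℤ), zpow_add, zpow_neg_one, MulAut.mul_apply, ih,
      map_leftPart hr' (hc (-n))]

theorem zpow_map_rightPart {e : MulAut (ℤ → G)} {r : ℕ}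
    (hr : ∀ (c : ℤ → G) (i : ℤ), (∀ j, i - r ≤ j → j ≤ i + r → c j = 1) → e c i = 1)
    (hr' : ∀ (c : ℤ → G) (i : ℤ), (∀ j, i - r ≤ j → j ≤ i + r → c j = 1) → e⁻¹ c i = 1)
    {c : ℤ → G} (hc : ∀ n j : ℤ, j.natAbs ≤ r → (e ^ n) c j = 1) (n : ℤ) :
    (e ^ n) (rightPart c) = rightPart ((e ^ n) c) := by
  apply mul_left_cancel (a := leftPart ((e ^ n) c))
  rw [leftPart_mul_rightPart, ← zpow_map_leftPart hr hr' hc n, ← map_mul, leftPart_mul_rightPart]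

/-- If every left front eventually moves right, no nontrivial orbit stays on the left. -/
theorem eq_one_of_forall_zpow_eq_one_right {e : MulAut (ℤ → G)}
    (h : ∀ k, ∀ c ∈ Lset G k, ∃ n : ℤ, ∃ j > k, (e ^ n) c j ≠ 1) {c : ℤ → G} {b : ℤ}
    (hc : ∀ n j : ℤ, b ≤ j → (e ^ n) c j = 1) : c = 1 := by
  by_contra hne
  obtain ⟨i, hi⟩ := Function.ne_iff.mp hne
  obtain ⟨k, ⟨n, hn⟩, hmax⟩ := Int.exists_greatest_of_bdd
    (P := fun j => ∃ n : ℤ, (e ^ n) c j ≠ 1)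
    ⟨b, fun z ⟨n, hn⟩ => by
      by_contra hz
      exact hn (hc n z (by omega))⟩
    ⟨i, 0, by simpa using hi⟩
  obtain ⟨m, j, hj, hm⟩ := h k ((e ^ n) c)
    ⟨hn, fun j hj => by
      by_contra hj'
      have := hmax j ⟨n, hj'⟩
      omega⟩
  have := hmax j ⟨m + n, by rwa [zpow_add, MulAut.mul_apply]⟩
  omega

/-- If every right front eventually moves left, no nontrivial orbit stays on the right. -/
theorem eq_one_of_forall_zpow_eq_one_left {e : MulAut (ℤ → G)}
    (h : ∀ k, ∀ c ∈ Rset G k, ∃ n : ℤ, ∃ j < k, (e ^ n) c j ≠ 1) {c : ℤ → G} {b : ℤ}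
    (hc : ∀ n j : ℤ, j ≤ b → (e ^ n) c j = 1) : c = 1 := by
  by_contra hne
  obtain ⟨i, hi⟩ := Function.ne_iff.mp hne
  obtain ⟨k, ⟨n, hn⟩, hmin⟩ := Int.exists_least_of_bdd
    (P := fun j => ∃ n : ℤ, (e ^ n) c j ≠ 1)
    ⟨b, fun z ⟨n, hn⟩ => by
      by_contra hz
      exact hn (hc n z (by omega))⟩
    ⟨i, 0, by simpa using hi⟩
  obtain ⟨m, j, hj, hm⟩ := h k ((e ^ n) c)
    ⟨hn, fun j hj => by
      by_contra hj'
      have := hmin j ⟨n, hj'⟩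
      omega⟩
  have := hmin j ⟨m + n, by rwa [zpow_add, MulAut.mul_apply]⟩
  omega

theorem continuous_mulAut_zpow [TopologicalSpace G] {e : MulAut (ℤ → G)} (hcont : Continuous e)
    (hcont' : Continuous ⇑(e⁻¹)) (n : ℤ) : Continuous ⇑(e ^ n) := by
  induction n using Int.induction_on with
  | zero => exact continuous_id
  | succ n ih => rw [zpow_add, zpow_one]; exact ih.comp hcont
  | pred n ih => rw [sub_eq_add_neg, zpow_add, zpow_neg_one]; exact ih.comp hcont'

/-- On a compact set, the time needed to reach an index set is uniformly bounded. -/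
theorem exists_uniform_time [TopologicalSpace G] [DiscreteTopology G]
    {e : MulAut (ℤ → G)} (hcont : ∀ n : ℤ, Continuous ⇑(e ^ n)) {K : Set (ℤ → G)}
    (hK : IsCompact K) {J : Set ℤ} (h : ∀ c ∈ K, ∃ n : ℤ, ∃ j ∈ J, (e ^ n) c j ≠ 1) :
    ∃ N : ℕ, ∀ c ∈ K, ∃ n : ℤ, n.natAbs ≤ N ∧ ∃ j ∈ J, (e ^ n) c j ≠ 1 := by
  let U : ℕ → Set (ℤ → G) := fun N => {c | ∃ n : ℤ, n.natAbs ≤ N ∧ ∃ j ∈ J, (e ^ n) c j ≠ 1}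
  have hU (N : ℕ) : IsOpen (U N) := by
    have : U N = ⋃ (n : ℤ) (_ : n.natAbs ≤ N) (j ∈ J), {c | (e ^ n) c j ≠ 1} := by
      ext c
      simp [U]
    rw [this]
    refine isOpen_iUnion fun n => isOpen_iUnion fun _ => isOpen_biUnion fun j _ => ?_
    exact (isOpen_discrete {(1 : G)}ᶜ).preimage ((continuous_apply j).comp (hcont n))
  have hmono : Monotone U := fun N M hNM c ⟨n, hn, hc⟩ => ⟨n, hn.trans hNM, hc⟩
  obtain ⟨N, hN⟩ := hK.elim_directed_cover U hU
    (fun c hc => by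
      obtain ⟨n, hn⟩ := h c hc
      exact Set.mem_iUnion.mpr ⟨n.natAbs, n, le_rfl, hn⟩) hmono.directed_le
  exact ⟨N, fun c hc => hN hc⟩

theorem isCompact_setOf_ne_one_and_eq_one [Finite G] [TopologicalSpace G] [DiscreteTopology G]
    (k : ℤ) (J : Set ℤ) : IsCompact {c : ℤ → G | c k ≠ 1 ∧ ∀ i ∈ J, c i = 1} := by
  apply IsClosed.isCompact
  have : {c : ℤ → G | c k ≠ 1 ∧ ∀ i ∈ J, c i = 1} =
      {c | c k ≠ 1} ∩ ⋂ i ∈ J, {c | c i = 1} := by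
    ext c
    simp
  rw [this]
  refine (IsClosed.preimage (continuous_apply (A := fun _ : ℤ => G) k)
    (isClosed_discrete {(1 : G)}ᶜ)).inter
    (isClosed_biInter fun i _ => ?_)
  exact IsClosed.preimage (continuous_apply (A := fun _ : ℤ => G) i) (isClosed_discrete {(1 : G)})

end MulAut

/-- an injective GCA is expansive iff there is a uniform bound `k_F` on the
number of iterations needed to move fronts. -/
theorem expansive_iff_uniform_fronts {G : Type*} [Group G] [Fintype G]
    (F : (ℤ → G) → (ℤ → G))
    (hcont : Continuous[configTop G, configTop G] F)
    (hshift : F ∘ shiftMap G = shiftMap G ∘ F)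
    (hhom : ∀ c c' : ℤ → G, F (c * c') = F c * F c')
    (hinj : Function.Injective F) (k : ℤ) :
    Expansive F ↔
      ∃ kF : ℕ, 0 < kF ∧
        ((∀ c ∈ Lset G k, ∃ n : ℤ, n.natAbs ≤ kF ∧ ∃ j > k, zIter F n c j ≠ 1) ∧
         (∀ c ∈ Rset G k, ∃ n : ℤ, n.natAbs ≤ kF ∧ ∃ j < k, zIter F n c j ≠ 1)) := by
  let _ : TopologicalSpace G := ⊥
  have : DiscreteTopology G := ⟨rfl⟩
  replace hcont : Continuous F := hcont
  have htrans := map_translate_of_comp_shiftMap hshift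
  let e : MulAut (ℤ → G) := MulEquiv.ofBijective (MonoidHom.mk' F hhom)
    ⟨hinj, surjective_of_injective_of_translate hcont htrans hinj⟩
  have heF : ⇑e = F := rfl
  have hcomm (t : ℤ) : Commute e (translation G t) := MulEquiv.ext fun c => htrans t c
  have hce : Continuous e := hcont
  have hce' : Continuous ⇑(e⁻¹) :=
    Continuous.continuous_symm_of_equiv_compact_to_t2 (f := e.toEquiv) hce
  rw [expansive_iff_exists_window]
  simp only [zIter_eq_zpow heF]
  constructor
  · rintro ⟨N, hN⟩
    have hwin (a : ℤ) (c : ℤ → G) (hc : c ≠ 1) :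
        ∃ n j : ℤ, j.natAbs < N ∧ (e ^ n) c (j + a) ≠ 1 := by
      have hne : (fun i => c (i + a)) ≠ 1 := fun h => hc <| by
        funext i
        simpa using congrFun h (i - a)
      obtain ⟨n, j, hj, h⟩ := hN _ _ hne
      refine ⟨n, j, hj, ?_⟩
      rwa [zpow_apply_translate hcomm, map_one] at h
    obtain ⟨N₁, h₁⟩ := exists_uniform_time (continuous_mulAut_zpow hce hce')
      (isCompact_setOf_ne_one_and_eq_one (G := G) k (Set.Ioi k)) (J := Set.Ioi k)
      (fun c hc => by
        obtain ⟨n, j, hj, h⟩ := hwin (k + N) c (fun h => hc.1 (congrFun h k))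
        exact ⟨n, _, show k < j + (k + N) by omega, h⟩)
    obtain ⟨N₂, h₂⟩ := exists_uniform_time (continuous_mulAut_zpow hce hce')
      (isCompact_setOf_ne_one_and_eq_one (G := G) k (Set.Iio k)) (J := Set.Iio k)
      (fun c hc => by
        obtain ⟨n, j, hj, h⟩ := hwin (k - N) c (fun h => hc.1 (congrFun h k))
        exact ⟨n, _, show j + (k - N) < k by omega, h⟩)
    refine ⟨N₁ + N₂ + 1, by omega, fun c hc => ?_, fun c hc => ?_⟩
    · obtain ⟨n, hn, h⟩ := h₁ c hc
      exact ⟨n, by omega, h⟩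
    · obtain ⟨n, hn, h⟩ := h₂ c hc
      exact ⟨n, by omega, h⟩
  · rintro ⟨kF, -, hL, hR⟩
    have hL' (l : ℤ) (c) (hc : c ∈ Lset G l) : ∃ n : ℤ, ∃ j > l, (e ^ n) c j ≠ 1 := by
      obtain ⟨n, -, j, hj, h⟩ := hL (fun i => c (i + (l - k)))
        ⟨by simpa using hc.1, fun i hi => hc.2 _ (by omega)⟩
      rw [zpow_apply_translate hcomm] at h
      exact ⟨n, _, by omega, h⟩
    have hR' (l : ℤ) (c) (hc : c ∈ Rset G l) : ∃ n : ℤ, ∃ j < l, (e ^ n) c j ≠ 1 := by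
      obtain ⟨n, -, j, hj, h⟩ := hR (fun i => c (i + (l - k)))
        ⟨by simpa using hc.1, fun i hi => hc.2 _ (by omega)⟩
      rw [zpow_apply_translate hcomm] at h
      exact ⟨n, _, by omega, h⟩
    obtain ⟨r₁, hr₁⟩ := exists_radius hce hcomm
    obtain ⟨r₂, hr₂⟩ := exists_radius hce' (fun t => (hcomm t).inv_left)
    let r := r₁ + r₂
    have hr (c : ℤ → G) (i : ℤ) (h : ∀ j, i - r ≤ j → j ≤ i + r → c j = 1) : e c i = 1 :=
      hr₁ c i fun j h1 h2 => h j (by omega) (by omega)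
    have hr' (c : ℤ → G) (i : ℤ) (h : ∀ j, i - r ≤ j → j ≤ i + r → c j = 1) : e⁻¹ c i = 1 :=
      hr₂ c i fun j h1 h2 => h j (by omega) (by omega)
    refine ⟨r + 1, fun c c' hne => ?_⟩
    by_contra! hcon
    have hc (n j : ℤ) (hj : j.natAbs ≤ r) : (e ^ n) (c / c') j = 1 := by
      rw [map_div, Pi.div_apply, hcon n j (by omega), div_self']
    have hleft : leftPart (c / c') = 1 :=
      eq_one_of_forall_zpow_eq_one_right hL' (b := 0) fun n j hj => by
        rw [zpow_map_leftPart hr hr' hc]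
        exact if_neg (by omega)
    have hright : rightPart (c / c') = 1 :=
      eq_one_of_forall_zpow_eq_one_left hR' (b := -1) fun n j hj => by
        rw [zpow_map_rightPart hr hr' hc]
        exact if_pos (by omega)
    apply hne
    rw [← div_eq_one, ← leftPart_mul_rightPart (c / c'), hleft, hright, mul_one]
end

section
/- Let G be a finite group and let F be an injective group cellular automaton on G that is expansive, with expansivity constant k_F. Let c ∈ L(k) be a lower angular configuration for F. Then for every integer i > 0 there exists j ∈ {1, …, k_F} such that pos(F^{i+j}(c)) > pos(F^{i}(c)). -/
open Function Topology

/-- A map commuting with the shift commutes with all integer translations. -/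
theorem apply_translate {A : Type*} {F : (ℤ → A) → (ℤ → A)}
    (hshift : F ∘ shiftMap A = shiftMap A ∘ F) (c : ℤ → A) (n : ℤ) :
    F (fun i => c (i + n)) = fun i => F c (i + n) := by
  have h1 : ∀ c : ℤ → A, F (fun i => c (i + 1)) = fun i => F c (i + 1) :=
    fun c => congrFun hshift c
  induction n using Int.induction_on generalizing c with
  | zero => simp
  | succ n ih =>
    have h := h1 (fun i => c (i + n))
    rw [ih] at h
    simpa only [add_assoc, add_comm (1 : ℤ)] using h
  | pred n ih =>
    have h := h1 (fun i => c (i + (-n - 1)))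
    have e : (fun i : ℤ => c (i + 1 + (-n - 1))) = fun i => c (i + -n) := by
      funext i; congr 1; ring
    rw [e, ih] at h
    funext i
    have hi := congrFun h (i - 1)
    simp only [sub_add_cancel] at hi
    rw [← hi]
    congr 1; ring

/-- A continuous shift-commuting map fixing the identity configuration moves the right end of
the support by a bounded amount. -/
theorem exists_bound_right_propagation {G : Type*} [One G] [TopologicalSpace G]
    [DiscreteTopology G] {F : (ℤ → G) → (ℤ → G)} (hcont : Continuous F)
    (hshift : F ∘ shiftMap G = shiftMap G ∘ F) (h1 : F 1 = 1) :
    ∃ B : ℤ, ∀ (K : ℤ) (c : ℤ → G), (∀ j > K, c j = 1) → ∀ j > K + B, F c j = 1 := by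
  have hopen : IsOpen {c : ℤ → G | F c 0 = 1} :=
    (isOpen_discrete ({1} : Set G)).preimage ((continuous_apply 0).comp hcont)
  obtain ⟨I, u, hu, hsub⟩ := isOpen_pi_iff.mp hopen 1 (by simp [h1])
  obtain ⟨B, hB⟩ := I.bddBelow
  refine ⟨-B, fun K c hc j hj => ?_⟩
  have hmem : (fun i => c (i + j)) ∈ {c : ℤ → G | F c 0 = 1} := by
    refine hsub fun a ha => ?_
    have := hB ha
    have hcj : c (a + j) = 1 := hc _ (by omega)
    simpa only [hcj, Pi.one_apply] using (hu a ha).2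
  rw [Set.mem_ofPred_eq, apply_translate hshift] at hmem
  simpa using hmem

/-- The configurations of period `m`. -/
def periodicConfigs (A : Type*) (m : ℤ) : Set (ℤ → A) := {c | ∀ i, c (i + m) = c i}

theorem periodicConfigs_apply_emod {A : Type*} {m : ℤ} {c : ℤ → A}
    (hc : c ∈ periodicConfigs A m) (i : ℤ) : c (i % m) = c i := by
  have hp : Function.Periodic c m := hc
  conv_rhs => rw [← Int.emod_add_mul_ediv i m, mul_comm]
  simpa using (hp.int_mul (i / m) (i % m)).symm

theorem finite_periodicConfigs {A : Type*} [Finite A] {m : ℤ} (hm : 0 < m) :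
    (periodicConfigs A m).Finite := by
  refine Set.Finite.of_finite_image (f := fun c (i : Set.Ico 0 m) => c i) (Set.toFinite _) ?_
  intro c hc c' hc' h
  funext i
  rw [← periodicConfigs_apply_emod hc, ← periodicConfigs_apply_emod hc']
  exact congrFun h ⟨i % m, Int.emod_nonneg _ hm.ne', Int.emod_lt_of_pos _ hm⟩

/-- Every configuration is a limit of periodic configurations. -/
theorem exists_periodic_tendsto {A : Type*} [TopologicalSpace A] (c : ℤ → A) :
    ∃ p : ℕ → ℤ → A, (∀ n : ℕ, p n ∈ periodicConfigs A (2 * n + 1)) ∧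
      Filter.Tendsto p Filter.atTop (𝓝 c) := by
  refine ⟨fun n i => c ((i + n) % (2 * n + 1) - n), fun n i => ?_, ?_⟩
  · simp only [add_right_comm i _ (n : ℤ), Int.add_emod_right]
  · refine tendsto_pi_nhds.mpr fun i => tendsto_const_nhds.congr' ?_
    filter_upwards [Filter.eventually_ge_atTop i.natAbs] with n hn
    rw [Int.emod_eq_of_lt (by omega) (by omega), add_sub_cancel_right]

/-- Injective cellular automata are surjective. -/
theorem surjective_of_injective_of_shift {A : Type*} [Finite A] [TopologicalSpace A]
    [DiscreteTopology A] {F : (ℤ → A) → (ℤ → A)} (hcont : Continuous F)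
    (hshift : F ∘ shiftMap A = shiftMap A ∘ F) (hinj : Injective F) : Surjective F := by
  intro c
  obtain ⟨p, hp, hlim⟩ := exists_periodic_tendsto c
  refine (isCompact_range hcont).isClosed.mem_of_tendsto hlim (Filter.Eventually.of_forall ?_)
  intro n
  have hmaps : Set.MapsTo F (periodicConfigs A (2 * n + 1)) (periodicConfigs A (2 * n + 1)) := by
    intro d hd i
    have hd' : (fun i => d (i + (2 * n + 1))) = d := funext hd
    rw [← congrFun (apply_translate hshift d (2 * n + 1)) i, hd']
  obtain ⟨q, -, hq⟩ := (((finite_periodicConfigs (by positivity)).injOn_iff_bijOn_of_mapsTo hmaps).mp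
    hinj.injOn).surjOn (hp n)
  exact ⟨q, hq⟩

theorem zIter_eq_zpow_s4 {A : Type*} [Nonempty A] {F : (ℤ → A) → (ℤ → A)} (hF : Bijective F)
    (n : ℤ) : zIter F n = ⇑(Equiv.ofBijective F hF ^ n) := by
  have hinv : invFun F = ⇑(Equiv.ofBijective F hF)⁻¹ := by
    funext c
    refine hF.injective ?_
    rw [invFun_eq (hF.surjective c)]
    exact ((Equiv.ofBijective F hF).apply_symm_apply c).symm
  unfold zIter
  split_ifs with h
  · obtain ⟨m, rfl⟩ := Int.eq_ofNat_of_zero_le h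
    rw [Int.toNat_natCast, zpow_natCast, ← Equiv.Perm.iterate_eq_pow]
    rfl
  · obtain ⟨m, rfl⟩ : ∃ m : ℕ, n = -m := ⟨(-n).toNat, by omega⟩
    rw [hinv, Equiv.Perm.iterate_eq_pow, neg_neg, Int.toNat_natCast, zpow_neg, zpow_natCast,
      inv_pow]

theorem mem_Lset_pos {G : Type*} [One G] {c : ℤ → G} (hne : c ≠ 1) {K : ℤ}
    (hK : ∀ j > K, c j = 1) : c ∈ Lset G (pos c) := by
  have hbdd : BddAbove {j : ℤ | c j ≠ 1} :=
    ⟨K, fun j hj => not_lt.mp fun h => hj (hK j h)⟩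
  refine ⟨Int.csSup_mem (Function.ne_iff.mp hne) hbdd, fun j hj => ?_⟩
  by_contra h
  exact (le_csSup hbdd h).not_gt hj

theorem pos_le {G : Type*} [One G] {c : ℤ → G} (hne : c ≠ 1) {K : ℤ}
    (hK : ∀ j > K, c j = 1) : pos c ≤ K :=
  csSup_le (Function.ne_iff.mp hne) fun j hj => not_lt.mp fun h => hj (hK j h)

theorem pos_eq_of_mem_Lset {G : Type*} [One G] {c : ℤ → G} {k : ℤ} (hc : c ∈ Lset G k) :
    pos c = k :=
  IsGreatest.csSup_eq ⟨hc.1, fun j hj => not_lt.mp fun h => hj (hc.2 j h)⟩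

/-- for an expansive injective GCA with expansivity constant `kF`, the position
of a lower angular left front increases, within `kF` forward iterations, at every positive
time. -/
theorem lowerAngular_pos_increases {G : Type*} [Group G] [Fintype G]
    (F : (ℤ → G) → (ℤ → G))
    (hcont : Continuous[configTop G, configTop G] F)
    (hshift : F ∘ shiftMap G = shiftMap G ∘ F)
    (hhom : ∀ c c' : ℤ → G, F (c * c') = F c * F c')
    (hinj : Function.Injective F)
    (hexp : Expansive F) (kF : ℕ) (hkF : ExpConstant F kF)
    (k : ℤ) (c : ℤ → G) (hc : c ∈ Lset G k)
    (hlower : ∀ i : ℕ, i ≤ kF → ∀ j > k, zIter F (-(i : ℤ)) c j = 1) :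
    ∀ i : ℤ, 0 < i → ∃ j : ℕ, 1 ≤ j ∧ j ≤ kF ∧
      pos (zIter F (i + (j : ℤ)) c) > pos (zIter F i c) := by
  let _ : TopologicalSpace G := ⊥
  have : DiscreteTopology G := ⟨rfl⟩
  have hcont' : Continuous F := hcont
  have hF : Bijective F := ⟨hinj, surjective_of_injective_of_shift hcont' hshift hinj⟩
  have hF1 : F 1 = 1 := by simpa using hhom 1 1
  obtain ⟨B, hB⟩ := exists_bound_right_propagation hcont' hshift hF1
  have hc1 : c ≠ 1 := Function.ne_iff.mpr ⟨k, hc.1⟩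
  simp only [ExpConstant, zIter_eq_zpow_s4 hF] at hkF hlower ⊢
  set e := Equiv.ofBijective F hF
  have he1 : e 1 = 1 := hF1
  have hne : ∀ n : ℤ, (e ^ n) c ≠ 1 := fun n h =>
    hc1 ((e ^ n).injective (h.trans (Equiv.Perm.zpow_apply_eq_self_of_apply_eq_self he1 n).symm))
  have hbound : ∀ n : ℕ, ∃ K : ℤ, ∀ j > K, (e ^ (n : ℤ)) c j = 1 := by
    intro n
    induction n with
    | zero => exact ⟨k, by simpa using hc.2⟩
    | succ n ih =>
      obtain ⟨K, hK⟩ := ih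
      refine ⟨K + B, ?_⟩
      rw [Nat.cast_succ, add_comm (n : ℤ), zpow_add, zpow_one]
      exact hB K _ hK
  intro i hi
  by_contra! hcon
  obtain ⟨t, ht, hmax⟩ := (Finset.Icc 0 i).exists_max_image (fun s => pos ((e ^ s) c))
    ⟨0, by simp [hi.le]⟩
  rw [Finset.mem_Icc] at ht
  obtain ⟨K, hK⟩ := hbound t.toNat
  rw [Int.toNat_of_nonneg ht.1] at hK
  obtain ⟨n, hn, hgt⟩ := (hkF.2 _).1 _ (mem_Lset_pos (hne t) hK)
  rw [← Equiv.Perm.mul_apply, ← zpow_add] at hgt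
  refine hgt.not_ge ?_
  rcases lt_or_ge (n + t) 0 with hneg | hnonneg
  · have h0 : pos ((e ^ (0 : ℤ)) c) = k := by simpa using pos_eq_of_mem_Lset hc
    have hlow := hlower (-(n + t)).toNat (by omega)
    rw [Int.toNat_of_nonneg (by omega), neg_neg] at hlow
    exact (pos_le (hne _) hlow).trans (h0.symm.le.trans (hmax 0 (by simp [hi.le])))
  · rcases le_or_gt (n + t) i with hle | hlt
    · exact hmax _ (Finset.mem_Icc.mpr ⟨hnonneg, hle⟩)
    · have hup := hcon (n + t - i).toNat (by omega) (by omega)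
      rw [Int.toNat_of_nonneg (by omega), add_sub_cancel] at hup
      exact hup.trans (hmax i (by simp [hi.le]))
end
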